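/- arXiv:1710.08133 — 5 statements merged into one kernel-verified Lean document; each statement's English description precedes it below -/
import Mathlib

section
/- Let ℓ > 0 and let α ∈ (−2, −2/3) ∪ (1/2, 1). For each energy h such that the equation h + r^(−α)/α − ℓ²/(2r²) = 0 has exactly two positive solutions r₋ < r₊, define the apsidal angle Θ_α(h) = ∫_{r₋}^{r₊} ℓ / (r² √(2(h + r^(−α)/α) − ℓ²/r²)) dr. Then Θ_α is a strictly decreasing function of h on the set of such admissible energies. -/
/-- The radial apsis equation `h + r^(-α)/α - ℓ²/(2r²) = 0` has exactly the two
positive solutions `rlo < rhi`. -/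
def IsTwoApsidal (α ℓ h rlo rhi : ℝ) : Prop :=
  0 < rlo ∧ rlo < rhi ∧
    h + rlo ^ (-α) / α - ℓ ^ 2 / (2 * rlo ^ 2) = 0 ∧
    h + rhi ^ (-α) / α - ℓ ^ 2 / (2 * rhi ^ 2) = 0 ∧
    ∀ r : ℝ, 0 < r → h + r ^ (-α) / α - ℓ ^ 2 / (2 * r ^ 2) = 0 → r = rlo ∨ r = rhi

/-- The apsidal angle at energy `h`, integrated between the apsidal radii `a < b`. -/
noncomputable def apsidalAngle (α ℓ h a b : ℝ) : ℝ :=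
  ∫ r in a..b, ℓ / (r ^ 2 * Real.sqrt (2 * (h + r ^ (-α) / α) - ℓ ^ 2 / r ^ 2))

open Set MeasureTheory

/-- The effective potential of exponent `β` in the normalized inverse-radius variable, shifted so
that its minimum value, attained at `1`, is `0`. -/
noncomputable def effPot (β t : ℝ) : ℝ := t ^ 2 / 2 - t ^ β / β + (1 / β - 1 / 2)

/-- The derivative of `effPot`. -/
noncomputable def effPotDeriv (β t : ℝ) : ℝ := t - t ^ (β - 1)

/-- The second derivative of `effPot`. -/
noncomputable def effPotDeriv₂ (β t : ℝ) : ℝ := 1 + (1 - β) * t ^ (β - 2)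

section EffPot

variable {β t : ℝ}

lemma effPot_one (β : ℝ) : effPot β 1 = 0 := by
  simp [effPot]

lemma effPotDeriv_one (β : ℝ) : effPotDeriv β 1 = 0 := by
  simp [effPotDeriv]

lemma hasDerivAt_effPot (hβ : β ≠ 0) (ht : 0 < t) :
    HasDerivAt (effPot β) (effPotDeriv β t) t := by
  have h := (((hasDerivAt_pow 2 t).div_const 2).sub
    ((Real.hasDerivAt_rpow_const (p := β) (Or.inl ht.ne')).div_const β)).add_const (1 / β - 1 / 2)
  refine h.congr_deriv ?_
  simp only [effPotDeriv]
  field_simp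
  norm_num
  ring

lemma hasDerivAt_effPotDeriv (ht : 0 < t) :
    HasDerivAt (effPotDeriv β) (effPotDeriv₂ β t) t := by
  have h := (hasDerivAt_id t).sub (Real.hasDerivAt_rpow_const (p := β - 1) (Or.inl ht.ne'))
  refine h.congr_deriv ?_
  simp only [effPotDeriv₂]
  rw [show β - 1 - 1 = β - 2 by ring]
  ring

lemma hasDerivAt_effPotDeriv₂ (ht : 0 < t) :
    HasDerivAt (effPotDeriv₂ β) (-((1 - β) * (2 - β) * t ^ (β - 2) / t)) t := by
  have h := ((Real.hasDerivAt_rpow_const (p := β - 2) (Or.inl ht.ne')).const_mul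
    (1 - β)).const_add 1
  refine h.congr_deriv ?_
  rw [Real.rpow_sub_one ht.ne']
  ring

lemma effPotDeriv_eq (ht : 0 < t) : effPotDeriv β t = t * (1 - t ^ (β - 2)) := by
  rw [effPotDeriv, show β - 1 = β - 2 + 1 by ring, Real.rpow_add_one ht.ne']
  ring

lemma effPotDeriv_pos (hβ : β < 2) (ht : 1 < t) : 0 < effPotDeriv β t := by
  rw [effPotDeriv_eq (by linarith)]
  have := Real.rpow_lt_one_of_one_lt_of_neg ht (show β - 2 < 0 by linarith)
  exact mul_pos (by linarith) (by linarith)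

lemma effPotDeriv_neg (hβ : β < 2) (ht₀ : 0 < t) (ht : t < 1) : effPotDeriv β t < 0 := by
  rw [effPotDeriv_eq ht₀]
  have := Real.one_lt_rpow_of_pos_of_lt_one_of_neg ht₀ ht (show β - 2 < 0 by linarith)
  exact mul_neg_of_pos_of_neg ht₀ (by linarith)

lemma effPotDeriv_ne_zero (hβ : β < 2) (ht₀ : 0 < t) (ht : t ≠ 1) : effPotDeriv β t ≠ 0 := by
  rcases lt_or_gt_of_ne ht with h | h
  · exact (effPotDeriv_neg hβ ht₀ h).ne
  · exact (effPotDeriv_pos hβ h).ne'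

lemma one_lt_effPotDeriv₂ (hβ : β < 1) (ht : 0 < t) : 1 < effPotDeriv₂ β t := by
  have : 0 < (1 - β) * t ^ (β - 2) := mul_pos (by linarith) (Real.rpow_pos_of_pos ht _)
  rw [effPotDeriv₂]
  linarith

/-- A function on `(0, ∞)` increasing before `1` and decreasing after `1` is smaller than its value
at `1` everywhere else. -/
lemma lt_apply_one_of_deriv {f f' : ℝ → ℝ} (hf : ∀ t, 0 < t → HasDerivAt f (f' t) t)
    (hlo : ∀ t, 0 < t → t < 1 → 0 < f' t) (hhi : ∀ t, 1 < t → f' t < 0)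
    (ht₀ : 0 < t) (ht : t ≠ 1) : f t < f 1 := by
  rcases lt_or_gt_of_ne ht with h | h
  · refine strictMonoOn_of_hasDerivWithinAt_pos (f' := f') (convex_Icc t 1)
      (fun x hx => (hf x (ht₀.trans_le hx.1)).continuousAt.continuousWithinAt) ?_ ?_
      (left_mem_Icc.2 h.le) (right_mem_Icc.2 h.le) h
    · intro x hx
      rw [interior_Icc] at hx
      exact (hf x (ht₀.trans hx.1)).hasDerivWithinAt
    · intro x hx
      rw [interior_Icc] at hx
      exact hlo x (ht₀.trans hx.1) hx.2
  · refine strictAntiOn_of_hasDerivWithinAt_neg (f' := f') (convex_Icc 1 t)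
      (fun x hx => (hf x (one_pos.trans_le hx.1)).continuousAt.continuousWithinAt) ?_ ?_
      (left_mem_Icc.2 h.le) (right_mem_Icc.2 h.le) h
    · intro x hx
      rw [interior_Icc] at hx
      exact (hf x (one_pos.trans hx.1)).hasDerivWithinAt
    · intro x hx
      rw [interior_Icc] at hx
      exact hhi x hx.1

lemma strictMonoOn_effPot (hβ₀ : β ≠ 0) (hβ : β < 2) : StrictMonoOn (effPot β) (Ici 1) := by
  refine strictMonoOn_of_hasDerivWithinAt_pos (f' := effPotDeriv β) (convex_Ici 1)
    (fun x hx => (hasDerivAt_effPot hβ₀ (one_pos.trans_le hx)).continuousAt.continuousWithinAt)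
    ?_ ?_ <;> intro x hx <;> rw [interior_Ici] at hx
  · exact (hasDerivAt_effPot hβ₀ (one_pos.trans hx)).hasDerivWithinAt
  · exact effPotDeriv_pos hβ hx

lemma strictAntiOn_effPot (hβ₀ : β ≠ 0) (hβ : β < 2) : StrictAntiOn (effPot β) (Ioc 0 1) := by
  refine strictAntiOn_of_hasDerivWithinAt_neg (f' := effPotDeriv β) (convex_Ioc 0 1)
    (fun x hx => (hasDerivAt_effPot hβ₀ hx.1).continuousAt.continuousWithinAt)
    ?_ ?_ <;> intro x hx <;> rw [interior_Ioc] at hx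
  · exact (hasDerivAt_effPot hβ₀ hx.1).hasDerivWithinAt
  · exact effPotDeriv_neg hβ hx.1 hx.2

lemma effPot_pos (hβ₀ : β ≠ 0) (hβ : β < 2) (ht₀ : 0 < t) (ht : t ≠ 1) : 0 < effPot β t := by
  rw [← effPot_one β]
  rcases lt_or_gt_of_ne ht with h | h
  · exact strictAntiOn_effPot hβ₀ hβ ⟨ht₀, h.le⟩ ⟨one_pos, le_rfl⟩ h
  · exact strictMonoOn_effPot hβ₀ hβ self_mem_Ici h.le h

lemma two_mul_effPot_le_sq (hβ₀ : β ≠ 0) (hβ : β < 1) (ht₀ : 0 < t) (ht : t ≠ 1) :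
    2 * effPot β t ≤ effPotDeriv β t ^ 2 := by
  have key := lt_apply_one_of_deriv (f := fun t => 2 * effPot β t - effPotDeriv β t ^ 2)
    (f' := fun t => 2 * effPotDeriv β t * (1 - effPotDeriv₂ β t)) (t := t) ?_ ?_ ?_ ht₀ ht
  · simp only [effPot_one, effPotDeriv_one] at key
    linarith
  · intro x hx
    refine (((hasDerivAt_effPot hβ₀ hx).const_mul 2).sub
      ((hasDerivAt_effPotDeriv hx).pow 2)).congr_deriv ?_
    norm_num
    ring
  · intro x hx hx1
    have := effPotDeriv_neg (show β < 2 by linarith) hx hx1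
    have := one_lt_effPotDeriv₂ hβ hx
    nlinarith
  · intro x hx
    have := effPotDeriv_pos (show β < 2 by linarith) hx
    have := one_lt_effPotDeriv₂ hβ (one_pos.trans hx)
    nlinarith

/-- The second derivative of `t` at the minimum of the potential, as a function of the signed
square root of twice the potential. -/
noncomputable def effPotSkew (β : ℝ) : ℝ := (1 - β) / (3 * (2 - β))

lemma sq_effPotDeriv_lt (hβ₀ : 1 / 2 < β) (hβ : β < 1) (ht₀ : 0 < t) (ht : t ≠ 1) :
    effPotDeriv β t ^ 2 - effPotSkew β * effPotDeriv β t ^ 3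
      < 2 * effPot β t * effPotDeriv₂ β t := by
  set κ := effPotSkew β with hκ
  set B : ℝ → ℝ := fun t => -(3 * κ * effPotDeriv₂ β t ^ 2)
    + (1 - κ * effPotDeriv β t) * ((1 - β) * (2 - β) * t ^ (β - 2) / t) with hB
  have hBeq : ∀ x, 0 < x → B x = (1 - β) / (2 - β) *
      ((x ^ (β - 2) - 1) * ((1 - β) * (2 * β - 1) / 3 * x ^ (β - 2) + 1)
        + (2 - β) ^ 2 * x ^ (β - 2) * (1 / x - 1)) := by
    intro x hx
    have : (2 - β) ≠ 0 := by linarith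
    simp only [hB, hκ, effPotSkew, effPotDeriv_eq hx, effPotDeriv₂]
    generalize x ^ (β - 2) = w
    field_simp
    ring
  have hc : 0 < (1 - β) / (2 - β) := div_pos (by linarith) (by linarith)
  have hA : 0 < (1 - β) * (2 * β - 1) / 3 := by
    have := mul_pos (show 0 < 1 - β by linarith) (show 0 < 2 * β - 1 by linarith)
    linarith
  have key := lt_apply_one_of_deriv
    (f := fun t => (effPotDeriv β t ^ 2 - κ * effPotDeriv β t ^ 3) / effPotDeriv₂ β t
      - 2 * effPot β t)
    (f' := fun t => effPotDeriv β t ^ 2 / effPotDeriv₂ β t ^ 2 * B t) (t := t) ?_ ?_ ?_ ht₀ ht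
  · have h2 := one_lt_effPotDeriv₂ hβ ht₀
    simp only [effPot_one, effPotDeriv_one] at key
    norm_num at key
    rwa [div_lt_iff₀ (by linarith)] at key
  · intro x hx
    have h2 := one_lt_effPotDeriv₂ hβ hx
    have hg := hasDerivAt_effPotDeriv (β := β) hx
    refine ((((hg.pow 2).sub ((hg.pow 3).const_mul κ)).div (hasDerivAt_effPotDeriv₂ hx)
      (by linarith)).sub ((hasDerivAt_effPot (by linarith) hx).const_mul 2)).congr_deriv ?_
    simp only [hB, Pi.pow_apply]
    have h2' : effPotDeriv₂ β x ≠ 0 := by linarith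
    generalize x ^ (β - 2) = w
    field_simp
    norm_num
    ring
  · intro x hx hx1
    have h2 := one_lt_effPotDeriv₂ hβ hx
    have hg := effPotDeriv_neg (show β < 2 by linarith) hx hx1
    have hw := Real.one_lt_rpow_of_pos_of_lt_one_of_neg hx hx1 (show β - 2 < 0 by linarith)
    have hx' : 1 < 1 / x := by rwa [lt_div_iff₀ hx, one_mul]
    have hA' := mul_pos hA (one_pos.trans hw)
    have hβ2 : 0 < 2 - β := by linarith
    rw [hBeq x hx]
    refine mul_pos (div_pos (sq_pos_of_neg hg) (by positivity)) (mul_pos hc (add_pos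
      (mul_pos (by linarith) (by linarith)) (mul_pos (mul_pos (by positivity) (by linarith))
      (by linarith))))
  · intro x hx
    have hx0 : 0 < x := one_pos.trans hx
    have h2 := one_lt_effPotDeriv₂ hβ hx0
    have hg := effPotDeriv_pos (show β < 2 by linarith) hx
    have hw := Real.rpow_lt_one_of_one_lt_of_neg hx (show β - 2 < 0 by linarith)
    have hw0 := Real.rpow_pos_of_pos hx0 (β - 2)
    have hx' : 1 / x < 1 := by rwa [div_lt_iff₀ hx0, one_mul]
    have hA' := mul_pos hA hw0
    have hβ2 : 0 < 2 - β := by linarith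
    rw [hBeq x hx0]
    refine mul_neg_of_pos_of_neg (by positivity) (mul_neg_of_pos_of_neg hc (add_neg
      (mul_neg_of_neg_of_pos (by linarith) (by linarith))
      (mul_neg_of_pos_of_neg (by positivity) (by linarith))))

end EffPot

lemma integral_Ioo_sin_zero_pi_div_two (c : ℝ) :
    ∫ θ in Ioo 0 (Real.pi / 2), c * Real.sin θ = c := by
  rw [← integral_Ioc_eq_integral_Ioo, ← intervalIntegral.integral_of_le (by positivity),
    intervalIntegral.integral_const_mul, integral_sin]
  simp

lemma mul_sin_mem_Ioo {A θ : ℝ} (hA : 0 < A) (hθ : θ ∈ Ioo 0 (Real.pi / 2)) :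
    A * Real.sin θ ∈ Ioo 0 A := by
  have h0 := Real.sin_pos_of_pos_of_lt_pi hθ.1 (by linarith [hθ.2, Real.pi_pos])
  have h1 : Real.sin θ < 1 := by
    rw [← Real.sin_pi_div_two]
    exact Real.sin_lt_sin_of_lt_of_le_pi_div_two (by linarith [hθ.1, Real.pi_pos])
      le_rfl hθ.2
  exact ⟨by positivity, by nlinarith⟩

section Substitution

variable {S : Set ℝ} {y y' W : ℝ → ℝ} {A : ℝ}

lemma image_arcsin_div (hA : 0 < A) (himg : y '' S = Ioo 0 A) :
    (fun t => Real.arcsin (y t / A)) '' S = Ioo 0 (Real.pi / 2) := by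
  ext θ
  constructor
  · rintro ⟨t, ht, rfl⟩
    have hy : y t ∈ Ioo 0 A := himg ▸ mem_image_of_mem y ht
    exact ⟨Real.arcsin_pos.2 (div_pos hy.1 hA),
      Real.arcsin_lt_pi_div_two.2 ((div_lt_one hA).2 hy.2)⟩
  · intro hθ
    obtain ⟨t, ht, hyt⟩ : A * Real.sin θ ∈ y '' S := himg ▸ mul_sin_mem_Ioo hA hθ
    refine ⟨t, ht, ?_⟩
    simp only [hyt]
    rw [mul_div_cancel_left₀ _ hA.ne', Real.arcsin_sin (by linarith [hθ.1, hθ.2]) hθ.2.le]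

lemma injOn_arcsin_div (hA : 0 < A) (himg : y '' S = Ioo 0 A) (hinj : InjOn y S) :
    InjOn (fun t => Real.arcsin (y t / A)) S := by
  intro t ht s hs hts
  have h : ∀ t ∈ S, -1 ≤ y t / A ∧ y t / A ≤ 1 := by
    intro t ht
    have hy : y t ∈ Ioo 0 A := himg ▸ mem_image_of_mem y ht
    exact ⟨by linarith [div_pos hy.1 hA], ((div_lt_one hA).2 hy.2).le⟩
  have := (Real.arcsin_inj (h t ht).1 (h t ht).2 (h s hs).1 (h s hs).2).1 hts
  exact hinj ht hs ((div_left_inj' hA.ne').1 this)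

lemma hasDerivAt_arcsin_div {t d : ℝ} (hA : 0 < A) (hy : y t ∈ Ioo 0 A)
    (hd : HasDerivAt y d t) :
    HasDerivAt (fun t => Real.arcsin (y t / A)) (d / √(A ^ 2 - y t ^ 2)) t := by
  have h0 : 0 < y t / A := div_pos hy.1 hA
  have h1 : y t / A < 1 := (div_lt_one hA).2 hy.2
  refine ((Real.hasDerivAt_arcsin (x := y t / A) (by linarith) h1.ne).comp t
    (hd.div_const A)).congr_deriv ?_
  have : 1 - (y t / A) ^ 2 = (A ^ 2 - y t ^ 2) / A ^ 2 := by
    field_simp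
  rw [this, Real.sqrt_div' _ (by positivity), Real.sqrt_sq hA.le]
  field_simp

lemma abs_deriv_smul_eq {t : ℝ} (hy' : y' t ≠ 0) (hW : W (y t) = 1 / |y' t|)
    (hy : y t ∈ Ioo 0 A) :
    |y' t / √(A ^ 2 - y t ^ 2)| • W (A * Real.sin (Real.arcsin (y t / A)))
      = 1 / √(A ^ 2 - y t ^ 2) := by
  have hA : 0 < A := hy.1.trans hy.2
  have h0 : 0 < y t / A := div_pos hy.1 hA
  have h1 : y t / A < 1 := (div_lt_one hA).2 hy.2
  rw [Real.sin_arcsin (by linarith) h1.le, mul_div_cancel₀ _ hA.ne', hW, abs_div,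
    abs_of_nonneg (Real.sqrt_nonneg _), smul_eq_mul]
  have := abs_pos.2 hy'
  field_simp

lemma integrableOn_one_div_sqrt_sub (hA : 0 < A) (hS : MeasurableSet S)
    (himg : y '' S = Ioo 0 A) (hinj : InjOn y S) (hderiv : ∀ t ∈ S, HasDerivAt y (y' t) t)
    (hy' : ∀ t ∈ S, y' t ≠ 0) (hW : ∀ t ∈ S, W (y t) = 1 / |y' t|)
    (hint : IntegrableOn (fun θ => W (A * Real.sin θ)) (Ioo 0 (Real.pi / 2))) :
    IntegrableOn (fun t => 1 / √(A ^ 2 - y t ^ 2)) S := by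
  have hy : ∀ t ∈ S, y t ∈ Ioo 0 A := fun t ht => himg ▸ mem_image_of_mem y ht
  rw [← image_arcsin_div hA himg, integrableOn_image_iff_integrableOn_abs_deriv_smul hS
    (fun t ht => (hasDerivAt_arcsin_div hA (hy t ht) (hderiv t ht)).hasDerivWithinAt)
    (injOn_arcsin_div hA himg hinj)] at hint
  exact hint.congr_fun (fun t ht => abs_deriv_smul_eq (hy' t ht) (hW t ht) (hy t ht)) hS

lemma integral_one_div_sqrt_sub (hA : 0 < A) (hS : MeasurableSet S)
    (himg : y '' S = Ioo 0 A) (hinj : InjOn y S) (hderiv : ∀ t ∈ S, HasDerivAt y (y' t) t)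
    (hy' : ∀ t ∈ S, y' t ≠ 0) (hW : ∀ t ∈ S, W (y t) = 1 / |y' t|) :
    ∫ t in S, 1 / √(A ^ 2 - y t ^ 2) = ∫ θ in Ioo 0 (Real.pi / 2), W (A * Real.sin θ) := by
  have hy : ∀ t ∈ S, y t ∈ Ioo 0 A := fun t ht => himg ▸ mem_image_of_mem y ht
  rw [← image_arcsin_div hA himg, integral_image_eq_integral_abs_deriv_smul hS
    (fun t ht => (hasDerivAt_arcsin_div hA (hy t ht) (hderiv t ht)).hasDerivWithinAt)
    (injOn_arcsin_div hA himg hinj)]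
  exact setIntegral_congr_fun hS
    (fun t ht => (abs_deriv_smul_eq (hy' t ht) (hW t ht) (hy t ht)).symm)

end Substitution

section Comparison

variable {W : ℝ → ℝ} {κ C A A₁ A₂ : ℝ}

lemma integrableOn_comp_mul_sin (hA : 0 < A)
    (hanti : AntitoneOn (fun x => W x - κ * x) (Ioo 0 A)) (hC : ∀ x ∈ Ioo 0 A, |W x| ≤ C) :
    IntegrableOn (fun θ => W (A * Real.sin θ)) (Ioo 0 (Real.pi / 2)) := by
  have hmono : MonotoneOn (fun θ => κ * (A * Real.sin θ) - W (A * Real.sin θ))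
      (Ioo 0 (Real.pi / 2)) := by
    intro θ hθ η hη h
    have := hanti (mul_sin_mem_Ioo hA hθ) (mul_sin_mem_Ioo hA hη)
      (mul_le_mul_of_nonneg_left (Real.sin_le_sin_of_le_of_le_pi_div_two
        (by linarith [hθ.1, Real.pi_pos]) hη.2.le h) hA.le)
    simp only at this ⊢
    linarith
  have hmeas := aemeasurable_restrict_of_monotoneOn (μ := volume) measurableSet_Ioo hmono
  have hmeas' : AEMeasurable (fun θ => W (A * Real.sin θ))
      (volume.restrict (Ioo 0 (Real.pi / 2))) := by
    have hc : AEMeasurable (fun θ => κ * (A * Real.sin θ))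
      (volume.restrict (Ioo 0 (Real.pi / 2))) := by fun_prop
    refine (hc.sub hmeas).congr (Filter.Eventually.of_forall fun θ => ?_)
    simp
  refine Integrable.of_bound (C := C) hmeas'.aestronglyMeasurable ?_
  exact (ae_restrict_mem measurableSet_Ioo).mono fun θ hθ => hC _ (mul_sin_mem_Ioo hA hθ)

lemma integral_comp_mul_sin_sub_lt (hA₁ : 0 < A₁) (hA : A₁ < A₂)
    (hanti : StrictAntiOn (fun x => W x - κ * x) (Ioo 0 A₂)) (hC : ∀ x ∈ Ioo 0 A₂, |W x| ≤ C) :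
    (∫ θ in Ioo 0 (Real.pi / 2), W (A₂ * Real.sin θ)) - κ * A₂
      < (∫ θ in Ioo 0 (Real.pi / 2), W (A₁ * Real.sin θ)) - κ * A₁ := by
  have hA₂ : 0 < A₂ := hA₁.trans hA
  have hsub : Ioo 0 A₁ ⊆ Ioo 0 A₂ := Ioo_subset_Ioo_right hA.le
  have i₁ := integrableOn_comp_mul_sin hA₁ (hanti.antitoneOn.mono hsub) fun x hx => hC x (hsub hx)
  have i₂ := integrableOn_comp_mul_sin hA₂ hanti.antitoneOn hC
  have hs : ∀ c : ℝ, IntegrableOn (fun θ => c * Real.sin θ) (Ioo 0 (Real.pi / 2)) := fun c =>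
    ((continuous_const.mul Real.continuous_sin).integrableOn_Icc).mono_set Ioo_subset_Icc_self
  have d₁ : IntegrableOn (fun θ => W (A₁ * Real.sin θ) - κ * A₁ * Real.sin θ)
    (Ioo 0 (Real.pi / 2)) := i₁.sub (hs _)
  have d₂ : IntegrableOn (fun θ => W (A₂ * Real.sin θ) - κ * A₂ * Real.sin θ)
    (Ioo 0 (Real.pi / 2)) := i₂.sub (hs _)
  rw [← integral_Ioo_sin_zero_pi_div_two (κ * A₂), ← integral_Ioo_sin_zero_pi_div_two (κ * A₁),
    ← integral_sub i₂ (hs _), ← integral_sub i₁ (hs _), ← sub_pos,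
    ← integral_sub d₁ d₂, ← integral_Ioc_eq_integral_Ioo,
    ← intervalIntegral.integral_of_le (by positivity)]
  refine intervalIntegral.intervalIntegral_pos_of_pos_on ?_ ?_ (by positivity)
  · rw [intervalIntegrable_iff_integrableOn_Ioo_of_le (by positivity)]
    exact d₁.sub d₂
  · intro θ hθ
    have h₁ := mul_sin_mem_Ioo hA₁ hθ
    have hsin : 0 < Real.sin θ := (pos_iff_pos_of_mul_pos h₁.1).1 hA₁
    have := hanti (hsub h₁) (mul_sin_mem_Ioo hA₂ hθ) (mul_lt_mul_of_pos_right hA hsin)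
    simp only at this ⊢
    linarith

end Comparison

/-- Two half-periods of a well, at amplitudes `A₁ < A₂`: if `1 / |y'| - κ y` decreases with the
square root `y` of the potential, then the half-period minus `κ` times the amplitude decreases. -/
lemma halfPeriod_sub_lt {S₁ S₂ : Set ℝ} {y y' : ℝ → ℝ} {κ C A₁ A₂ : ℝ}
    (hA₁ : 0 < A₁) (hA : A₁ < A₂) (hS₁ : MeasurableSet S₁) (hS₂ : MeasurableSet S₂)
    (hS : S₁ ⊆ S₂) (h₁ : y '' S₁ = Ioo 0 A₁) (h₂ : y '' S₂ = Ioo 0 A₂) (hinj : InjOn y S₂)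
    (hderiv : ∀ t ∈ S₂, HasDerivAt y (y' t) t) (hy' : ∀ t ∈ S₂, y' t ≠ 0)
    (hanti : ∀ t ∈ S₂, ∀ s ∈ S₂, y t < y s → 1 / |y' s| - κ * y s < 1 / |y' t| - κ * y t)
    (hC : ∀ t ∈ S₂, 1 / |y' t| ≤ C) :
    IntegrableOn (fun t => 1 / √(A₁ ^ 2 - y t ^ 2)) S₁ ∧
    IntegrableOn (fun t => 1 / √(A₂ ^ 2 - y t ^ 2)) S₂ ∧
    (∫ t in S₂, 1 / √(A₂ ^ 2 - y t ^ 2)) - κ * A₂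
      < (∫ t in S₁, 1 / √(A₁ ^ 2 - y t ^ 2)) - κ * A₁ := by
  set W : ℝ → ℝ := fun x => 1 / |y' (Function.invFunOn y S₂ x)| with hWdef
  have hW : ∀ t ∈ S₂, W (y t) = 1 / |y' t| := fun t ht => by
    simp only [hWdef, hinj.leftInvOn_invFunOn ht]
  have hA₂ : 0 < A₂ := hA₁.trans hA
  have hWanti : StrictAntiOn (fun x => W x - κ * x) (Ioo 0 A₂) := by
    rw [← h₂]
    rintro _ ⟨t, ht, rfl⟩ _ ⟨s, hs, rfl⟩ hlt
    simp only [hW t ht, hW s hs]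
    exact hanti t ht s hs hlt
  have hWC : ∀ x ∈ Ioo 0 A₂, |W x| ≤ C := by
    rw [← h₂]
    rintro _ ⟨t, ht, rfl⟩
    rw [hW t ht, abs_of_nonneg (by positivity)]
    exact hC t ht
  have hsub : Ioo 0 A₁ ⊆ Ioo 0 A₂ := Ioo_subset_Ioo_right hA.le
  have hinj₁ := hinj.mono hS
  have hd₁ : ∀ t ∈ S₁, HasDerivAt y (y' t) t := fun t ht => hderiv t (hS ht)
  have hy'₁ : ∀ t ∈ S₁, y' t ≠ 0 := fun t ht => hy' t (hS ht)
  have hW₁ : ∀ t ∈ S₁, W (y t) = 1 / |y' t| := fun t ht => hW t (hS ht)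
  refine ⟨integrableOn_one_div_sqrt_sub hA₁ hS₁ h₁ hinj₁ hd₁ hy'₁ hW₁
      (integrableOn_comp_mul_sin hA₁ (hWanti.antitoneOn.mono hsub) fun x hx => hWC x (hsub hx)),
    integrableOn_one_div_sqrt_sub hA₂ hS₂ h₂ hinj hderiv hy' hW
      (integrableOn_comp_mul_sin hA₂ hWanti.antitoneOn hWC), ?_⟩
  rw [integral_one_div_sqrt_sub hA₁ hS₁ h₁ hinj₁ hd₁ hy'₁ hW₁,
    integral_one_div_sqrt_sub hA₂ hS₂ h₂ hinj hderiv hy' hW]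
  exact integral_comp_mul_sin_sub_lt hA₁ hA hWanti hWC

section Well

variable {β t : ℝ}

lemma hasDerivAt_sqrt_effPot (hβ₀ : β ≠ 0) (hβ : β < 2) (ht₀ : 0 < t) (ht : t ≠ 1) :
    HasDerivAt (fun t => √(2 * effPot β t)) (effPotDeriv β t / √(2 * effPot β t)) t := by
  have hG := effPot_pos hβ₀ hβ ht₀ ht
  refine (((hasDerivAt_effPot hβ₀ ht₀).const_mul 2).sqrt (by positivity)).congr_deriv ?_
  rw [mul_div_mul_left _ _ two_ne_zero]

lemma hasDerivAt_sqrt_effPot_div_sub (hβ₀ : 1 / 2 < β) (hβ : β < 1) (ht₀ : 0 < t) (ht : t ≠ 1) :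
    ∃ d < 0, HasDerivAt
      (fun t => √(2 * effPot β t) / effPotDeriv β t - effPotSkew β * √(2 * effPot β t)) d t := by
  have hβ' : β ≠ 0 := by linarith
  have hG := effPot_pos hβ' (show β < 2 by linarith) ht₀ ht
  have hg := effPotDeriv_ne_zero (show β < 2 by linarith) ht₀ ht
  have hy := hasDerivAt_sqrt_effPot hβ' (show β < 2 by linarith) ht₀ ht
  refine ⟨_, ?_, (hy.div (hasDerivAt_effPotDeriv ht₀) hg).sub (hy.const_mul (effPotSkew β))⟩
  have hsq : √(2 * effPot β t) ^ 2 = 2 * effPot β t := Real.sq_sqrt (by positivity)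
  have hpos : 0 < √(2 * effPot β t) := Real.sqrt_pos.2 (by positivity)
  have key := sq_effPotDeriv_lt hβ₀ hβ ht₀ ht
  rw [← hsq] at key
  have hg2 : 0 < effPotDeriv β t ^ 2 := by positivity
  generalize √(2 * effPot β t) = y at *
  have : (effPotDeriv β t / y * effPotDeriv β t - y * effPotDeriv₂ β t) / effPotDeriv β t ^ 2
      - effPotSkew β * (effPotDeriv β t / y)
      = (effPotDeriv β t ^ 2 - effPotSkew β * effPotDeriv β t ^ 3 - y ^ 2 * effPotDeriv₂ β t)
        / (y * effPotDeriv β t ^ 2) := by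
    field_simp
    ring
  rw [this]
  exact div_neg_of_neg_of_pos (by linarith) (by positivity)

lemma strictAntiOn_sqrt_effPot_div_sub (hβ₀ : 1 / 2 < β) (hβ : β < 1) {S : Set ℝ}
    (hS : Convex ℝ S) (hS' : ∀ t ∈ S, 0 < t ∧ t ≠ 1) :
    StrictAntiOn
      (fun t => √(2 * effPot β t) / effPotDeriv β t - effPotSkew β * √(2 * effPot β t)) S := by
  choose! d hd hderiv using fun t (ht : t ∈ S) =>
    hasDerivAt_sqrt_effPot_div_sub hβ₀ hβ (hS' t ht).1 (hS' t ht).2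
  exact strictAntiOn_of_hasDerivWithinAt_neg hS
    (fun t ht => (hderiv t ht).continuousAt.continuousWithinAt)
    (fun t ht => (hderiv t (interior_subset ht)).hasDerivWithinAt)
    (fun t ht => hd t (interior_subset ht))

lemma one_div_abs_deriv_sqrt_effPot_le (hβ₀ : β ≠ 0) (hβ : β < 1) (ht₀ : 0 < t) (ht : t ≠ 1) :
    1 / |effPotDeriv β t / √(2 * effPot β t)| ≤ 1 := by
  have hg := abs_pos.2 (effPotDeriv_ne_zero (show β < 2 by linarith) ht₀ ht)
  rw [abs_div, abs_of_nonneg (Real.sqrt_nonneg _), one_div_div, div_le_one hg,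
    ← Real.sqrt_sq_eq_abs]
  exact Real.sqrt_le_sqrt (two_mul_effPot_le_sq hβ₀ hβ ht₀ ht)

lemma deriv_sqrt_effPot_ne_zero (hβ₀ : β ≠ 0) (hβ : β < 2) (ht₀ : 0 < t) (ht : t ≠ 1) :
    effPotDeriv β t / √(2 * effPot β t) ≠ 0 :=
  div_ne_zero (effPotDeriv_ne_zero hβ ht₀ ht)
    (Real.sqrt_pos.2 (by linarith [effPot_pos hβ₀ hβ ht₀ ht])).ne'

lemma strictMonoOn_sqrt_effPot (hβ₀ : β ≠ 0) (hβ : β < 2) :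
    StrictMonoOn (fun t => √(2 * effPot β t)) (Ici 1) := by
  intro t ht s hs h
  have h0 : 0 ≤ effPot β t := by
    rw [← effPot_one β]
    exact (strictMonoOn_effPot hβ₀ hβ).monotoneOn self_mem_Ici ht ht
  have := strictMonoOn_effPot hβ₀ hβ ht hs h
  exact Real.sqrt_lt_sqrt (by linarith) (by linarith)

lemma strictAntiOn_sqrt_effPot (hβ₀ : β ≠ 0) (hβ : β < 2) :
    StrictAntiOn (fun t => √(2 * effPot β t)) (Ioc 0 1) := by
  intro t ht s hs h
  have h0 : 0 ≤ effPot β s := by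
    rw [← effPot_one β]
    exact (strictAntiOn_effPot hβ₀ hβ).antitoneOn hs ⟨one_pos, le_rfl⟩ hs.2
  have := strictAntiOn_effPot hβ₀ hβ ht hs h
  exact Real.sqrt_lt_sqrt (by linarith) (by linarith)

lemma continuousOn_sqrt_effPot (hβ₀ : β ≠ 0) :
    ContinuousOn (fun t => √(2 * effPot β t)) (Ioi 0) := fun _ ht =>
  ((hasDerivAt_effPot hβ₀ ht).continuousAt.const_mul 2).sqrt.continuousWithinAt

lemma image_sqrt_effPot_Ioo_one_right (hβ₀ : β ≠ 0) (hβ : β < 2) {q : ℝ} (hq : 1 < q) :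
    (fun t => √(2 * effPot β t)) '' Ioo 1 q = Ioo 0 √(2 * effPot β q) := by
  have hmono := strictMonoOn_sqrt_effPot hβ₀ hβ
  have h1 : √(2 * effPot β 1) = 0 := by simp [effPot_one]
  rw [← h1]
  refine Subset.antisymm ?_ (intermediate_value_Ioo hq.le
    ((continuousOn_sqrt_effPot hβ₀).mono fun _ ht => one_pos.trans_le ht.1))
  rintro _ ⟨t, ht, rfl⟩
  exact ⟨hmono self_mem_Ici ht.1.le ht.1, hmono ht.1.le hq.le ht.2⟩

lemma image_sqrt_effPot_Ioo_one_left (hβ₀ : β ≠ 0) (hβ : β < 2) {p : ℝ} (hp₀ : 0 < p)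
    (hp : p < 1) :
    (fun t => √(2 * effPot β t)) '' Ioo p 1 = Ioo 0 √(2 * effPot β p) := by
  have hanti := strictAntiOn_sqrt_effPot hβ₀ hβ
  have h1 : √(2 * effPot β 1) = 0 := by simp [effPot_one]
  rw [← h1]
  refine Subset.antisymm ?_ (intermediate_value_Ioo' hp.le
    ((continuousOn_sqrt_effPot hβ₀).mono fun _ ht => hp₀.trans_le ht.1))
  rintro _ ⟨t, ht, rfl⟩
  have ht' : t ∈ Ioc 0 1 := ⟨hp₀.trans ht.1, ht.2.le⟩
  exact ⟨hanti ht' ⟨one_pos, le_rfl⟩ ht.2, hanti ⟨hp₀, hp.le⟩ ht' ht.1⟩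

lemma halfPeriod_right (hβ₀ : 1 / 2 < β) (hβ : β < 1) {q₁ q₂ : ℝ} (hq₁ : 1 < q₁) (hq : q₁ < q₂) :
    IntegrableOn (fun t => 1 / √(√(2 * effPot β q₁) ^ 2 - √(2 * effPot β t) ^ 2)) (Ioo 1 q₁) ∧
    IntegrableOn (fun t => 1 / √(√(2 * effPot β q₂) ^ 2 - √(2 * effPot β t) ^ 2)) (Ioo 1 q₂) ∧
    (∫ t in Ioo 1 q₂, 1 / √(√(2 * effPot β q₂) ^ 2 - √(2 * effPot β t) ^ 2))
        - effPotSkew β * √(2 * effPot β q₂)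
      < (∫ t in Ioo 1 q₁, 1 / √(√(2 * effPot β q₁) ^ 2 - √(2 * effPot β t) ^ 2))
        - effPotSkew β * √(2 * effPot β q₁) := by
  have hβ' : β ≠ 0 := by linarith
  have hβ2 : β < 2 := by linarith
  have hq₂ := hq₁.trans hq
  have hS : ∀ t ∈ Ioo 1 q₂, 0 < t ∧ t ≠ 1 := fun t ht => ⟨one_pos.trans ht.1, ht.1.ne'⟩
  have hmono := (strictMonoOn_sqrt_effPot hβ' hβ2).mono
    (Ioo_subset_Icc_self.trans Icc_subset_Ici_self : Ioo 1 q₂ ⊆ Ici 1)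
  have hanti := strictAntiOn_sqrt_effPot_div_sub hβ₀ hβ (convex_Ioo 1 q₂) hS
  have habs : ∀ t ∈ Ioo 1 q₂, 1 / |effPotDeriv β t / √(2 * effPot β t)|
      = √(2 * effPot β t) / effPotDeriv β t := by
    intro t ht
    rw [abs_div, abs_of_nonneg (Real.sqrt_nonneg _), one_div_div,
      abs_of_pos (effPotDeriv_pos hβ2 ht.1)]
  refine halfPeriod_sub_lt (y := fun t => √(2 * effPot β t)) (C := 1)
    (Real.sqrt_pos.2 (by linarith [effPot_pos hβ' hβ2 (one_pos.trans hq₁) hq₁.ne']))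
    (strictMonoOn_sqrt_effPot hβ' hβ2 hq₁.le hq₂.le hq) measurableSet_Ioo measurableSet_Ioo
    (Ioo_subset_Ioo_right hq.le) (image_sqrt_effPot_Ioo_one_right hβ' hβ2 hq₁)
    (image_sqrt_effPot_Ioo_one_right hβ' hβ2 hq₂) hmono.injOn
    (fun t ht => hasDerivAt_sqrt_effPot hβ' hβ2 (hS t ht).1 (hS t ht).2)
    (fun t ht => deriv_sqrt_effPot_ne_zero hβ' hβ2 (hS t ht).1 (hS t ht).2) ?_
    (fun t ht => one_div_abs_deriv_sqrt_effPot_le hβ' hβ (hS t ht).1 (hS t ht).2)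
  intro t ht s hs hlt
  rw [habs t ht, habs s hs]
  exact hanti ht hs ((hmono.lt_iff_lt ht hs).1 hlt)

lemma halfPeriod_left (hβ₀ : 1 / 2 < β) (hβ : β < 1) {p₁ p₂ : ℝ} (hp₂ : 0 < p₂) (hp : p₂ < p₁)
    (hp₁ : p₁ < 1) :
    IntegrableOn (fun t => 1 / √(√(2 * effPot β p₁) ^ 2 - √(2 * effPot β t) ^ 2)) (Ioo p₁ 1) ∧
    IntegrableOn (fun t => 1 / √(√(2 * effPot β p₂) ^ 2 - √(2 * effPot β t) ^ 2)) (Ioo p₂ 1) ∧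
    (∫ t in Ioo p₂ 1, 1 / √(√(2 * effPot β p₂) ^ 2 - √(2 * effPot β t) ^ 2))
        - -effPotSkew β * √(2 * effPot β p₂)
      < (∫ t in Ioo p₁ 1, 1 / √(√(2 * effPot β p₁) ^ 2 - √(2 * effPot β t) ^ 2))
        - -effPotSkew β * √(2 * effPot β p₁) := by
  have hβ' : β ≠ 0 := by linarith
  have hβ2 : β < 2 := by linarith
  have hp₁' := hp₂.trans hp
  have hS : ∀ t ∈ Ioo p₂ 1, 0 < t ∧ t ≠ 1 := fun t ht => ⟨hp₂.trans ht.1, ht.2.ne⟩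
  have hmono := (strictAntiOn_sqrt_effPot hβ' hβ2).mono
    (fun _ ht => ⟨(hS _ ht).1, ht.2.le⟩ : Ioo p₂ 1 ⊆ Ioc 0 1)
  have hanti := strictAntiOn_sqrt_effPot_div_sub hβ₀ hβ (convex_Ioo p₂ 1) hS
  have habs : ∀ t ∈ Ioo p₂ 1, 1 / |effPotDeriv β t / √(2 * effPot β t)|
      = -(√(2 * effPot β t) / effPotDeriv β t) := by
    intro t ht
    rw [abs_div, abs_of_nonneg (Real.sqrt_nonneg _), one_div_div,
      abs_of_neg (effPotDeriv_neg hβ2 (hS t ht).1 ht.2), div_neg]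
  refine halfPeriod_sub_lt (y := fun t => √(2 * effPot β t)) (C := 1)
    (Real.sqrt_pos.2 (by linarith [effPot_pos hβ' hβ2 hp₁' hp₁.ne]))
    (strictAntiOn_sqrt_effPot hβ' hβ2 ⟨hp₂, (hp.trans hp₁).le⟩ ⟨hp₁', hp₁.le⟩ hp)
    measurableSet_Ioo measurableSet_Ioo
    (Ioo_subset_Ioo_left hp.le) (image_sqrt_effPot_Ioo_one_left hβ' hβ2 hp₁' hp₁)
    (image_sqrt_effPot_Ioo_one_left hβ' hβ2 hp₂ (hp.trans hp₁)) hmono.injOn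
    (fun t ht => hasDerivAt_sqrt_effPot hβ' hβ2 (hS t ht).1 (hS t ht).2)
    (fun t ht => deriv_sqrt_effPot_ne_zero hβ' hβ2 (hS t ht).1 (hS t ht).2) ?_
    (fun t ht => one_div_abs_deriv_sqrt_effPot_le hβ' hβ (hS t ht).1 (hS t ht).2)
  intro t ht s hs hlt
  rw [habs t ht, habs s hs]
  have := hanti hs ht ((hmono.lt_iff_gt ht hs).1 hlt)
  simp only at this
  linarith

/-- The roots of `effPot β = e` on the positive axis lie on both sides of `1`. -/
lemma lt_one_and_one_lt_of_effPot_eq (hβ₀ : β ≠ 0) (hβ : β < 2) {p q : ℝ} (hp : 0 < p)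
    (hpq : p < q) (h : effPot β p = effPot β q) : p < 1 ∧ 1 < q := by
  constructor <;> by_contra! hc
  · exact (strictMonoOn_effPot hβ₀ hβ hc (hc.trans hpq.le) hpq).ne h
  · exact (strictAntiOn_effPot hβ₀ hβ ⟨hp, (hpq.trans_le hc).le⟩ ⟨hp.trans hpq, hc⟩ hpq).ne' h

lemma effPot_nonneg (hβ₀ : β ≠ 0) (hβ : β < 2) (ht : 0 < t) : 0 ≤ effPot β t := by
  rcases eq_or_ne t 1 with rfl | h
  · exact (effPot_one β).ge
  · exact (effPot_pos hβ₀ hβ ht h).le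

/-- Half the period of the oscillation between `p` and `q` at energy `e` in the well `effPot`. -/
noncomputable def wellTime (β e p q : ℝ) : ℝ := ∫ t in Ioo p q, 1 / √(2 * (e - effPot β t))

lemma wellTime_eq_add (hβ₀ : β ≠ 0) (hβ : β < 2) {e p q : ℝ} (hp₀ : 0 < p) (hp : p < 1)
    (hq : 1 < q) (hpe : effPot β p = e) (hqe : effPot β q = e)
    (hl : IntegrableOn (fun t => 1 / √(√(2 * effPot β p) ^ 2 - √(2 * effPot β t) ^ 2)) (Ioo p 1))
    (hr : IntegrableOn (fun t => 1 / √(√(2 * effPot β q) ^ 2 - √(2 * effPot β t) ^ 2))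
      (Ioo 1 q)) :
    wellTime β e p q
      = (∫ t in Ioo p 1, 1 / √(√(2 * effPot β p) ^ 2 - √(2 * effPot β t) ^ 2))
        + ∫ t in Ioo 1 q, 1 / √(√(2 * effPot β q) ^ 2 - √(2 * effPot β t) ^ 2) := by
  have he : 0 ≤ e := hpe ▸ effPot_nonneg hβ₀ hβ hp₀
  rw [hpe] at hl ⊢
  rw [hqe] at hr ⊢
  have hcongr : wellTime β e p q
      = ∫ t in Ioo p q, 1 / √(√(2 * e) ^ 2 - √(2 * effPot β t) ^ 2) := by
    refine setIntegral_congr_fun measurableSet_Ioo fun t ht => ?_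
    have := effPot_nonneg hβ₀ hβ (hp₀.trans ht.1)
    rw [Real.sq_sqrt (by positivity), Real.sq_sqrt (by positivity), mul_sub]
  rw [hcongr]
  simp only [← integral_Ioc_eq_integral_Ioo]
  rw [← intervalIntegral.integral_of_le (hp.trans hq).le, ← intervalIntegral.integral_of_le hp.le,
    ← intervalIntegral.integral_of_le hq.le, intervalIntegral.integral_add_adjacent_intervals]
  · exact (intervalIntegrable_iff_integrableOn_Ioo_of_le hp.le).2 hl
  · exact (intervalIntegrable_iff_integrableOn_Ioo_of_le hq.le).2 hr

lemma wellTime_lt (hβ₀ : 1 / 2 < β) (hβ : β < 1) {e₁ e₂ p₁ q₁ p₂ q₂ : ℝ} (he : e₁ < e₂)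
    (hp₁ : 0 < p₁) (hpq₁ : p₁ < q₁) (hp₁e : effPot β p₁ = e₁) (hq₁e : effPot β q₁ = e₁)
    (hp₂ : 0 < p₂) (hpq₂ : p₂ < q₂) (hp₂e : effPot β p₂ = e₂) (hq₂e : effPot β q₂ = e₂) :
    wellTime β e₂ p₂ q₂ < wellTime β e₁ p₁ q₁ := by
  have hβ' : β ≠ 0 := by linarith
  have hβ2 : β < 2 := by linarith
  obtain ⟨hp₁1, hq₁1⟩ := lt_one_and_one_lt_of_effPot_eq hβ' hβ2 hp₁ hpq₁ (hp₁e.trans hq₁e.symm)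
  obtain ⟨hp₂1, hq₂1⟩ := lt_one_and_one_lt_of_effPot_eq hβ' hβ2 hp₂ hpq₂ (hp₂e.trans hq₂e.symm)
  have hq : q₁ < q₂ := ((strictMonoOn_effPot hβ' hβ2).lt_iff_lt hq₁1.le hq₂1.le).1
    (by rwa [hq₁e, hq₂e])
  have hp : p₂ < p₁ := ((strictAntiOn_effPot hβ' hβ2).lt_iff_gt ⟨hp₁, hp₁1.le⟩ ⟨hp₂, hp₂1.le⟩).1
    (by rwa [hp₁e, hp₂e])
  obtain ⟨r₁, r₂, hr⟩ := halfPeriod_right hβ₀ hβ hq₁1 hq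
  obtain ⟨l₁, l₂, hl⟩ := halfPeriod_left hβ₀ hβ hp₂ hp hp₁1
  rw [wellTime_eq_add hβ' hβ2 hp₁ hp₁1 hq₁1 hp₁e hq₁e l₁ r₁,
    wellTime_eq_add hβ' hβ2 hp₂ hp₂1 hq₂1 hp₂e hq₂e l₂ r₂]
  rw [hp₁e, hp₂e] at hl ⊢
  rw [hq₁e, hq₂e] at hr ⊢
  linarith

end Well

section Transformation

variable {α β ℓ h e ρ k : ℝ}

/-- The power substitution `r = ρ * t ^ (-k)` turns the apsidal angle into the half-period of the
well `effPot β`. -/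
lemma IsTwoApsidal.exists_apsidalAngle_eq {a b : ℝ} (H : IsTwoApsidal α ℓ h a b) (hℓ : 0 < ℓ)
    (hρ : 0 < ρ) (hk : 0 < k)
    (hid : ∀ t, 0 < t → 2 * (h + (ρ * t ^ (-k)) ^ (-α) / α) - ℓ ^ 2 / (ρ * t ^ (-k)) ^ 2
      = (ℓ / ρ * (t ^ k / t)) ^ 2 * (2 * (e - effPot β t))) :
    ∃ p q, 0 < p ∧ p < q ∧ effPot β p = e ∧ effPot β q = e ∧
      apsidalAngle α ℓ h a b = k * wellTime β e p q := by
  obtain ⟨ha, hab, hra, hrb, -⟩ := H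
  have hb := ha.trans hab
  set f : ℝ → ℝ := fun t => ρ * t ^ (-k) with hf
  set f' : ℝ → ℝ := fun t => ρ * (-k * t ^ (-k - 1)) with hf'
  have hinv : ∀ r, 0 < r → f ((r / ρ) ^ (-k)⁻¹) = r := fun r hr => by
    simp only [hf]
    rw [Real.rpow_inv_rpow (div_pos hr hρ).le (by linarith), mul_div_cancel₀ _ hρ.ne']
  have hanti : StrictAntiOn f (Ioi 0) := fun t ht s hs hts =>
    mul_lt_mul_of_pos_left (Real.rpow_lt_rpow_of_neg ht hts (by linarith)) hρ
  have hroot : ∀ r, 0 < r → h + r ^ (-α) / α - ℓ ^ 2 / (2 * r ^ 2) = 0 →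
      effPot β ((r / ρ) ^ (-k)⁻¹) = e := by
    intro r hr hr0
    have ht : 0 < (r / ρ) ^ (-k)⁻¹ := Real.rpow_pos_of_pos (div_pos hr hρ) _
    have h1 := hid _ ht
    have h2 : ρ * ((r / ρ) ^ (-k)⁻¹) ^ (-k) = r := hinv r hr
    have h3 : ℓ ^ 2 / (2 * r ^ 2) = ℓ ^ 2 / r ^ 2 / 2 := by
      field_simp
    rw [h2, show 2 * (h + r ^ (-α) / α) - ℓ ^ 2 / r ^ 2 = 0 by linarith] at h1
    have h4 : (ℓ / ρ * (((r / ρ) ^ (-k)⁻¹) ^ k / (r / ρ) ^ (-k)⁻¹)) ^ 2 ≠ 0 := by positivity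
    linarith [(mul_eq_zero.1 h1.symm).resolve_left h4]
  set p := (b / ρ) ^ (-k)⁻¹ with hp
  set q := (a / ρ) ^ (-k)⁻¹ with hq
  have hp0 : 0 < p := Real.rpow_pos_of_pos (div_pos hb hρ) _
  have hq0 : 0 < q := Real.rpow_pos_of_pos (div_pos ha hρ) _
  have hfp : f p = b := hinv b hb
  have hfq : f q = a := hinv a ha
  have hpq : p < q := (hanti.lt_iff_gt hq0 hp0).1 (by rwa [hfp, hfq])
  have hderiv : ∀ t, 0 < t → HasDerivAt f (f' t) t := fun t ht =>
    (Real.hasDerivAt_rpow_const (Or.inl ht.ne')).const_mul ρ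
  have hsub : Ioo p q ⊆ Ioi 0 := fun t ht => hp0.trans ht.1
  have himg : f '' Ioo p q = Ioo a b := by
    refine Subset.antisymm ?_ ?_
    · rintro _ ⟨t, ht, rfl⟩
      rw [← hfp, ← hfq]
      exact ⟨hanti (hsub ht) hq0 ht.2, hanti hp0 (hsub ht) ht.1⟩
    · rw [← hfp, ← hfq]
      exact intermediate_value_Ioo' hpq.le fun t ht =>
        (hderiv t (hp0.trans_le ht.1)).continuousAt.continuousWithinAt
  refine ⟨p, q, hp0, hpq, hroot b hb hrb, hroot a ha hra, ?_⟩
  rw [apsidalAngle, intervalIntegral.integral_of_le hab.le, integral_Ioc_eq_integral_Ioo, ← himg,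
    integral_image_eq_integral_abs_deriv_smul measurableSet_Ioo
      (fun t ht => (hderiv t (hsub ht)).hasDerivWithinAt) (hanti.injOn.mono hsub),
    wellTime, ← integral_const_mul]
  refine setIntegral_congr_fun measurableSet_Ioo fun t ht => ?_
  have ht0 : 0 < t := hsub ht
  have hx : 0 < t ^ k := Real.rpow_pos_of_pos ht0 k
  simp only [hf, hf', smul_eq_mul]
  rw [hid t ht0, Real.sqrt_mul (by positivity), Real.sqrt_sq (by positivity),
    Real.rpow_sub_one ht0.ne', Real.rpow_neg ht0.le, abs_mul, abs_mul, abs_neg, abs_of_pos hρ,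
    abs_of_pos hk, abs_of_pos (by positivity)]
  rcases (Real.sqrt_nonneg (2 * (e - effPot β t))).eq_or_lt with h0 | h0
  · simp [← h0]
  · field_simp

end Transformation

section Cases

variable {α ℓ h : ℝ}

lemma IsTwoApsidal.exists_eq_wellTime_of_pos {a b : ℝ} (H : IsTwoApsidal α ℓ h a b) (hℓ : 0 < ℓ)
    (hα₀ : 0 < α) (hα : α < 2) :
    ∃ p q, 0 < p ∧ p < q ∧ effPot α p = h / (ℓ / ℓ ^ (2 / (2 - α))) ^ 2 + (1 / α - 1 / 2) ∧
      effPot α q = h / (ℓ / ℓ ^ (2 / (2 - α))) ^ 2 + (1 / α - 1 / 2) ∧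
      apsidalAngle α ℓ h a b
        = wellTime α (h / (ℓ / ℓ ^ (2 / (2 - α))) ^ 2 + (1 / α - 1 / 2)) p q := by
  have hα2 : 2 - α ≠ 0 := by linarith
  have hρ : 0 < ℓ ^ (2 / (2 - α)) := Real.rpow_pos_of_pos hℓ _
  have hpow : (ℓ ^ (2 / (2 - α))) ^ (-α) = (ℓ / ℓ ^ (2 / (2 - α))) ^ 2 := by
    have : (ℓ ^ (2 / (2 - α))) ^ (2 - α) = ℓ ^ 2 := by
      rw [← Real.rpow_mul hℓ.le, div_mul_cancel₀ _ hα2, Real.rpow_two]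
    rw [div_pow, ← this, show -α = 2 - α - 2 by ring, Real.rpow_sub hρ _ 2, Real.rpow_two]
  generalize ℓ ^ (2 / (2 - α)) = ρ at *
  have key := H.exists_apsidalAngle_eq (β := α) (e := h / (ℓ / ρ) ^ 2 + (1 / α - 1 / 2)) hℓ hρ
    one_pos ?_
  · simpa only [one_mul] using key
  · intro t ht
    have ht' : 0 < t⁻¹ := inv_pos.2 ht
    rw [Real.rpow_neg_one, Real.rpow_one, Real.mul_rpow hρ.le ht'.le, hpow, Real.inv_rpow ht.le,
      Real.rpow_neg ht.le, inv_inv, effPot]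
    generalize t ^ α = w
    field_simp
    ring

lemma IsTwoApsidal.energy_pos {a b : ℝ} (H : IsTwoApsidal α ℓ h a b) (hα : α < 0) : 0 < h := by
  obtain ⟨ha, -, hra, -, -⟩ := H
  have h1 : a ^ (-α) / α < 0 := div_neg_of_pos_of_neg (Real.rpow_pos_of_pos ha _) hα
  have h2 : 0 ≤ ℓ ^ 2 / (2 * a ^ 2) := by positivity
  linarith

/-- The energy of the dual well, of exponent `-2 * α / (2 - α)`, for a negative exponent `α`. -/
noncomputable def dualEnergy (α ℓ h : ℝ) : ℝ :=
  1 / (-2 * α / (2 - α)) - 1 / 2 +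
    (ℓ / √(-2 * α / (2 - α) * h)) ^ (-α) / (α * (-2 * α / (2 - α) * h))

lemma dual_exponent_pos (hα : α < 0) : 0 < -2 * α / (2 - α) :=
  div_pos (by linarith) (by linarith)

lemma dualEnergy_lt (hℓ : 0 < ℓ) (hα : α < 0) {h₁ h₂ : ℝ} (h₁_pos : 0 < h₁) (hh : h₁ < h₂) :
    dualEnergy α ℓ h₁ < dualEnergy α ℓ h₂ := by
  have hβ := dual_exponent_pos hα
  rw [dualEnergy, dualEnergy]
  generalize -2 * α / (2 - α) = β at *
  have h1 : 0 < β * h₁ := by positivity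
  have h12 : β * h₁ < β * h₂ := mul_lt_mul_of_pos_left hh hβ
  have hs : 0 < √(β * h₁) := Real.sqrt_pos.2 h1
  have hs12 : √(β * h₁) < √(β * h₂) := Real.sqrt_lt_sqrt h1.le h12
  have hρ : ℓ / √(β * h₂) < ℓ / √(β * h₁) := div_lt_div_of_pos_left hℓ hs hs12
  have hpow : (ℓ / √(β * h₂)) ^ (-α) < (ℓ / √(β * h₁)) ^ (-α) :=
    Real.rpow_lt_rpow (div_pos hℓ (hs.trans hs12)).le hρ (by linarith)
  have hdiv : (ℓ / √(β * h₂)) ^ (-α) / (β * h₂) < (ℓ / √(β * h₁)) ^ (-α) / (β * h₁) :=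
    div_lt_div₀ hpow h12.le (Real.rpow_nonneg (div_pos hℓ hs).le _) h1
  have := div_lt_div_of_neg_of_lt hα hdiv
  rw [div_div, div_div, mul_comm _ α, mul_comm _ α] at this
  linarith

lemma IsTwoApsidal.exists_eq_wellTime_of_neg {a b : ℝ} (H : IsTwoApsidal α ℓ h a b) (hℓ : 0 < ℓ)
    (hα : α < 0) :
    ∃ p q, 0 < p ∧ p < q ∧ effPot (-2 * α / (2 - α)) p = dualEnergy α ℓ h ∧
      effPot (-2 * α / (2 - α)) q = dualEnergy α ℓ h ∧
      apsidalAngle α ℓ h a b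
        = 2 / (2 - α) * wellTime (-2 * α / (2 - α)) (dualEnergy α ℓ h) p q := by
  have h_pos := H.energy_pos hα
  have hβ := dual_exponent_pos hα
  have hα2 : 0 < 2 - α := by linarith
  have hβk : -2 * α / (2 - α) = 2 - 2 * (2 / (2 - α)) := by
    field_simp
    ring
  have hkα : -(2 / (2 - α)) * -α = 2 * (2 / (2 - α)) - 2 := by
    field_simp
    ring
  have hk : 0 < 2 / (2 - α) := by positivity
  have hs : 0 < √(-2 * α / (2 - α) * h) := Real.sqrt_pos.2 (mul_pos hβ h_pos)
  refine H.exists_apsidalAngle_eq hℓ (div_pos hℓ hs) hk ?_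
  intro t ht
  have hsq : √(-2 * α / (2 - α) * h) ^ 2 = -2 * α / (2 - α) * h :=
    Real.sq_sqrt (mul_pos hβ h_pos).le
  rw [dualEnergy, effPot]
  rw [Real.mul_rpow (div_pos hℓ hs).le (Real.rpow_nonneg ht.le _), ← Real.rpow_mul ht.le, hkα]
  generalize 2 / (2 - α) = k at *
  generalize -2 * α / (2 - α) = β at *
  generalize √(β * h) = s at *
  have hx : 0 < t ^ k := Real.rpow_pos_of_pos ht k
  have hx2 : t ^ (2 * k) = (t ^ k) ^ 2 := by
    rw [mul_comm, Real.rpow_mul ht.le, Real.rpow_two]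
  rw [hβk, Real.rpow_sub ht, Real.rpow_sub ht, Real.rpow_neg ht.le, hx2, Real.rpow_two, ← hβk]
  generalize (ℓ / s) ^ (-α) = z at *
  generalize t ^ k = x at *
  have hα0 := hα.ne
  rw [show ℓ / (ℓ / s) = s by field_simp,
    show ℓ ^ 2 / (ℓ / s * x⁻¹) ^ 2 = s ^ 2 * x ^ 2 by field_simp, mul_pow, hsq]
  field_simp
  ring

end Cases

/-- For `ℓ > 0` and `α ∈ (-2, -2/3) ∪ (1/2, 1)`, the apsidal angle is a strictly
decreasing function of the energy on the set of admissible energies. -/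
theorem apsidalAngle_strictAnti (α ℓ : ℝ) (hℓ : 0 < ℓ)
    (hα : (-2 < α ∧ α < -2/3) ∨ (1/2 < α ∧ α < 1))
    (h₁ h₂ : ℝ) (hh : h₁ < h₂) (a₁ b₁ a₂ b₂ : ℝ)
    (H₁ : IsTwoApsidal α ℓ h₁ a₁ b₁) (H₂ : IsTwoApsidal α ℓ h₂ a₂ b₂) :
    apsidalAngle α ℓ h₂ a₂ b₂ < apsidalAngle α ℓ h₁ a₁ b₁ := by
  rcases hα with ⟨hα₁, hα₂⟩ | ⟨hα₁, hα₂⟩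
  · have hα : α < 0 := by linarith
    have hα2 : 0 < 2 - α := by linarith
    obtain ⟨p₁, q₁, hp₁, hpq₁, hp₁e, hq₁e, h₁_eq⟩ := H₁.exists_eq_wellTime_of_neg hℓ hα
    obtain ⟨p₂, q₂, hp₂, hpq₂, hp₂e, hq₂e, h₂_eq⟩ := H₂.exists_eq_wellTime_of_neg hℓ hα
    rw [h₁_eq, h₂_eq]
    refine mul_lt_mul_of_pos_left (wellTime_lt ?_ ?_ (dualEnergy_lt hℓ hα (H₁.energy_pos hα) hh)
      hp₁ hpq₁ hp₁e hq₁e hp₂ hpq₂ hp₂e hq₂e) (by positivity)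
    · rw [lt_div_iff₀ hα2]
      linarith
    · rw [div_lt_one hα2]
      linarith
  · have hα : 0 < α := by linarith
    obtain ⟨p₁, q₁, hp₁, hpq₁, hp₁e, hq₁e, h₁_eq⟩ :=
      H₁.exists_eq_wellTime_of_pos hℓ hα (by linarith)
    obtain ⟨p₂, q₂, hp₂, hpq₂, hp₂e, hq₂e, h₂_eq⟩ :=
      H₂.exists_eq_wellTime_of_pos hℓ hα (by linarith)
    rw [h₁_eq, h₂_eq]
    have hc : 0 < (ℓ / ℓ ^ (2 / (2 - α))) ^ 2 := by positivity
    have he := div_lt_div_of_pos_right hh hc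
    exact wellTime_lt hα₁ hα₂ (by linarith) hp₁ hpq₁ hp₁e hq₁e hp₂ hpq₂ hp₂e hq₂e
end

section
/- Let ℓ > 0, α < 2 with α ≠ 0, let I ⊆ ℝ be an open interval and let r₋, r₊ : I → (0, ∞) be differentiable functions such that for every h ∈ I both r₋(h) and r₊(h) satisfy h + r^(−α)/α − ℓ²/(2r²) = 0 and r₋(h) < ℓ^(2/(2−α)) < r₊(h). Then the orbital eccentricity e(h) = (r₊(h) − r₋(h)) / (r₊(h) + r₋(h)) is differentiable with e'(h) > 0 for all h ∈ I; that is, e is a strictly increasing function of the energy. -/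
/-- Implicit differentiation of the apsis equation. -/
lemma apsis_deriv_mul_eq_one {α ℓ h r' : ℝ} (hα0 : α ≠ 0) {r : ℝ → ℝ} (hpos : 0 < r h)
    (hr : HasDerivAt r r' h)
    (heq : ∀ᶠ x in nhds h, x + r x ^ (-α) / α - ℓ ^ 2 / (2 * r x ^ 2) = 0) :
    r' * (r h ^ (-α - 1) - ℓ ^ 2 / r h ^ 3) = 1 := by
  have hd := ((hasDerivAt_id h).add ((hr.rpow_const (p := -α) (Or.inl hpos.ne')).div_const α)).sub
    ((hasDerivAt_const h (ℓ ^ 2)).div ((hr.pow 2).const_mul 2)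
      (by simp only [Pi.pow_apply]; positivity))
  have hz := hd.unique ((hasDerivAt_const h (0 : ℝ)).congr_of_eventuallyEq heq)
  have hne := hpos.ne'
  simp only [Pi.pow_apply] at hz
  field_simp at hz ⊢
  apply mul_left_cancel₀ (mul_ne_zero two_ne_zero hne)
  linear_combination -hz

/-- The sign of the derivative of the effective potential is determined by the position
relative to the circular radius. -/
lemma effective_force_eq {α ℓ r : ℝ} (hr : 0 < r) :
    r ^ (-α - 1) - ℓ ^ 2 / r ^ 3 = (r ^ (2 - α) - ℓ ^ 2) / r ^ 3 := by
  rw [sub_div, ← Real.rpow_natCast r 3, ← Real.rpow_sub hr]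
  congr 2
  push_cast
  ring

lemma circular_radius_rpow {α ℓ : ℝ} (hℓ : 0 < ℓ) (hα2 : α < 2) :
    (ℓ ^ (2 / (2 - α))) ^ (2 - α) = ℓ ^ 2 := by
  rw [← Real.rpow_mul hℓ.le, div_mul_cancel₀ _ (by linarith), Real.rpow_two]

/-- For fixed angular momentum `ℓ > 0`, the orbital eccentricity
`e(h) = (r₊(h) - r₋(h)) / (r₊(h) + r₋(h))` is differentiable with positive derivative,
hence a strictly increasing function of the energy. -/
theorem eccentricity_strictMono (α ℓ : ℝ) (hℓ : 0 < ℓ) (hα2 : α < 2) (hα0 : α ≠ 0)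
    (I : Set ℝ) (hIopen : IsOpen I) (hIconn : I.OrdConnected)
    (rlo rhi : ℝ → ℝ)
    (hposlo : ∀ h ∈ I, 0 < rlo h)
    (hposhi : ∀ h ∈ I, 0 < rhi h)
    (hdifflo : ∀ h ∈ I, DifferentiableAt ℝ rlo h)
    (hdiffhi : ∀ h ∈ I, DifferentiableAt ℝ rhi h)
    (heqlo : ∀ h ∈ I, h + (rlo h) ^ (-α) / α - ℓ ^ 2 / (2 * (rlo h) ^ 2) = 0)
    (heqhi : ∀ h ∈ I, h + (rhi h) ^ (-α) / α - ℓ ^ 2 / (2 * (rhi h) ^ 2) = 0)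
    (horder : ∀ h ∈ I, rlo h < ℓ ^ (2 / (2 - α)) ∧ ℓ ^ (2 / (2 - α)) < rhi h) :
    (∀ h ∈ I, DifferentiableAt ℝ (fun h => (rhi h - rlo h) / (rhi h + rlo h)) h ∧
      0 < deriv (fun h => (rhi h - rlo h) / (rhi h + rlo h)) h) ∧
    StrictMonoOn (fun h => (rhi h - rlo h) / (rhi h + rlo h)) I := by
  have key : ∀ h ∈ I, DifferentiableAt ℝ (fun h => (rhi h - rlo h) / (rhi h + rlo h)) h ∧
      0 < deriv (fun h => (rhi h - rlo h) / (rhi h + rlo h)) h := by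
    intro h hh
    have hI := hIopen.mem_nhds hh
    have hlo := hposlo h hh
    have hhi := hposhi h hh
    have dlo := (hdifflo h hh).hasDerivAt
    have dhi := (hdiffhi h hh).hasDerivAt
    have elo := apsis_deriv_mul_eq_one hα0 hlo dlo (Filter.eventually_of_mem hI heqlo)
    have ehi := apsis_deriv_mul_eq_one hα0 hhi dhi (Filter.eventually_of_mem hI heqhi)
    rw [effective_force_eq hlo] at elo
    rw [effective_force_eq hhi] at ehi
    have hα : 0 < 2 - α := by linarith
    have hlt := Real.rpow_lt_rpow hlo.le (horder h hh).1 hα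
    have hgt := Real.rpow_lt_rpow (Real.rpow_pos_of_pos hℓ _).le (horder h hh).2 hα
    rw [circular_radius_rpow hℓ hα2] at hlt hgt
    have slo : deriv rlo h < 0 :=
      neg_of_mul_pos_left (elo ▸ one_pos) (div_neg_of_neg_of_pos (by linarith) (by positivity)).le
    have shi : 0 < deriv rhi h :=
      pos_of_mul_pos_left (ehi ▸ one_pos) (div_pos (by linarith) (by positivity)).le
    have de := (dhi.sub dlo).div (dhi.add dlo) (by simp only [Pi.add_apply]; positivity)
    refine ⟨de.differentiableAt, ?_⟩
    have hval := de.deriv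
    change deriv (fun h => (rhi h - rlo h) / (rhi h + rlo h)) h = _ at hval
    rw [hval]
    simp only [Pi.add_apply, Pi.sub_apply]
    apply div_pos _ (by positivity)
    nlinarith [mul_pos shi hlo, mul_pos (neg_pos.2 slo) hhi]
  refine ⟨key, strictMonoOn_of_deriv_pos hIconn.convex
    (fun h hh => (key h hh).1.continuousAt.continuousWithinAt) fun h hh => ?_⟩
  exact (key h (interior_subset hh)).2
end

section
/- Let ℓ > 0, α < 2 with α ≠ 0, and let h be such that the equation h + r^(−α)/α − ℓ²/(2r²) = 0 has exactly two positive solutions r₋ < r₊. Then, with W_{ℓ,α}(ρ) = ρ²/2 − (ℓ^(−α)/α) ρ^α and ρ₋ = ℓ/r₊, ρ₊ = ℓ/r₋, one has the change-of-variables identity ∫_{r₋}^{r₊} ℓ / (r² √(2(h + r^(−α)/α) − ℓ²/r²)) dr = ∫_{ρ₋}^{ρ₊} 1 / √(2(h − W_{ℓ,α}(ρ))) dρ. -/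
/-- The Clairaut potential `W_{ℓ,α}(ρ) = ρ²/2 - (ℓ^(-α)/α) ρ^α`. -/
noncomputable def W (α ℓ ρ : ℝ) : ℝ := ρ ^ 2 / 2 - ℓ ^ (-α) / α * ρ ^ α

theorem image_const_div_Icc {c a b : ℝ} (hc : 0 < c) (ha : 0 < a) (hab : a ≤ b) :
    (fun r : ℝ => c / r) '' Set.Icc a b = Set.Icc (c / b) (c / a) := by
  have hb := ha.trans_le hab
  ext ρ
  constructor
  · rintro ⟨r, ⟨har, hrb⟩, rfl⟩
    have hr := ha.trans_le har
    exact ⟨div_le_div_of_nonneg_left hc.le hr hrb, div_le_div_of_nonneg_left hc.le ha har⟩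
  · rintro ⟨h₁, h₂⟩
    have hρ : 0 < ρ := (div_pos hc hb).trans_le h₁
    refine ⟨c / ρ, ⟨?_, ?_⟩, ?_⟩
    · rwa [le_div_comm₀ ha hρ]
    · rwa [div_le_comm₀ hρ hb]
    · exact div_div_cancel₀ hc.ne'

/-- The substitution `ρ = c / r`, with no integrability hypothesis on the integrand. -/
theorem intervalIntegral_const_div {c a b : ℝ} (hc : 0 < c) (ha : 0 < a) (hab : a ≤ b)
    (g : ℝ → ℝ) :
    ∫ ρ in (c / b)..(c / a), g ρ = ∫ r in a..b, c / r ^ 2 * g (c / r) := by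
  have hderiv : ∀ r ∈ Set.Icc a b,
      HasDerivWithinAt (fun r : ℝ => c / r) (-(c / r ^ 2)) (Set.Icc a b) r := by
    intro r hr
    have hr0 : r ≠ 0 := (ha.trans_le hr.1).ne'
    have h := (hasDerivAt_inv hr0).const_mul c
    refine HasDerivAt.hasDerivWithinAt ?_
    simpa only [div_eq_mul_inv, mul_neg] using h
  have hinj : Set.InjOn (fun r : ℝ => c / r) (Set.Icc a b) := fun x _ y _ hxy =>
    inv_injective (mul_left_cancel₀ hc.ne' (by simpa only [div_eq_mul_inv] using hxy))
  rw [intervalIntegral.integral_of_le hab,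
    intervalIntegral.integral_of_le (div_le_div_of_nonneg_left hc.le ha hab),
    ← MeasureTheory.integral_Icc_eq_integral_Ioc, ← MeasureTheory.integral_Icc_eq_integral_Ioc,
    ← image_const_div_Icc hc ha hab,
    MeasureTheory.integral_image_eq_integral_abs_deriv_smul measurableSet_Icc hderiv hinj]
  refine MeasureTheory.setIntegral_congr_fun measurableSet_Icc fun r _ => ?_
  have hnonneg : 0 ≤ c / r ^ 2 := by positivity
  simp only [abs_neg, abs_of_nonneg hnonneg, smul_eq_mul]

theorem W_div {α ℓ r : ℝ} (hℓ : 0 < ℓ) (hr : 0 < r) :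
    W α ℓ (ℓ / r) = ℓ ^ 2 / r ^ 2 / 2 - r ^ (-α) / α := by
  have hpow : ℓ ^ α ≠ 0 := (Real.rpow_pos_of_pos hℓ α).ne'
  rw [W, div_pow, Real.div_rpow hℓ.le hr.le, Real.rpow_neg hℓ.le, Real.rpow_neg hr.le]
  field_simp

/-- Clairaut's change of variables `ρ = ℓ/r` transforms the apsidal-angle integral into
the time integral of the abstract oscillator with potential `W_{ℓ,α}`. -/
theorem apsidalAngle_change_of_variables (α ℓ h : ℝ) (hℓ : 0 < ℓ) (hα2 : α < 2)
    (hα0 : α ≠ 0) (rlo rhi : ℝ) (H : IsTwoApsidal α ℓ h rlo rhi) :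
    ∫ r in rlo..rhi, ℓ / (r ^ 2 * Real.sqrt (2 * (h + r ^ (-α) / α) - ℓ ^ 2 / r ^ 2)) =
      ∫ ρ in (ℓ / rhi)..(ℓ / rlo), 1 / Real.sqrt (2 * (h - W α ℓ ρ)) := by
  obtain ⟨hlo, hlt, -⟩ := H
  rw [intervalIntegral_const_div hℓ hlo hlt.le]
  refine intervalIntegral.integral_congr fun r hr => ?_
  rw [Set.uIcc_of_le hlt.le] at hr
  have hr0 : 0 < r := hlo.trans_le hr.1
  have hrad : 2 * (h - W α ℓ (ℓ / r)) = 2 * (h + r ^ (-α) / α) - ℓ ^ 2 / r ^ 2 := by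
    rw [W_div hℓ hr0]
    ring
  simp only [hrad, div_mul_div_comm, mul_one]
end

section
/- Let ℓ > 0 and 0 < α < 2. For every energy h with ((α−2)/(2α)) ℓ^(2α/(α−2)) < h < 0, the equation h + r^(−α)/α − ℓ²/(2r²) = 0 has exactly two positive solutions r₋ < r₊. -/
open Set in
/-- A continuous strictly concave function on `[0, ∞)` that is negative at `0`, positive at `c` and
negative at some `d > c` has exactly two zeros. -/
theorem StrictConcaveOn.exists_two_zeros {f : ℝ → ℝ} (hf : StrictConcaveOn ℝ (Ici 0) f)
    (hcont : Continuous f) {c d : ℝ} (hc : 0 < c) (hcd : c < d)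
    (h0 : f 0 < 0) (hfc : 0 < f c) (hfd : f d < 0) :
    ∃ x y : ℝ, 0 < x ∧ x < y ∧ f x = 0 ∧ f y = 0 ∧ ∀ z : ℝ, 0 < z → f z = 0 → z = x ∨ z = y := by
  obtain ⟨x, ⟨hx0, hxc⟩, hx⟩ := intermediate_value_Ioo hc.le hcont.continuousOn ⟨h0, hfc⟩
  obtain ⟨y, ⟨hcy, -⟩, hy⟩ := intermediate_value_Ioo' hcd.le hcont.continuousOn ⟨hfd, hfc⟩
  have not_three : ∀ {u v w : ℝ}, 0 < u → u < v → v < w → f u = 0 → f v = 0 → f w = 0 → False := by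
    intro u v w hu huv hvw hfu hfv hfw
    have := hf.slope_anti_adjacent (mem_Ici.2 hu.le) (mem_Ici.2 (hu.trans (huv.trans hvw)).le)
      huv hvw
    simp [hfu, hfv, hfw] at this
  refine ⟨x, y, hx0, hxc.trans hcy, hx, hy, fun z hz hfz => ?_⟩
  by_contra! hne
  rcases lt_or_gt_of_ne hne.1 with hzx | hxz
  · exact not_three hz hzx (hxc.trans hcy) hfz hx hy
  · rcases lt_or_gt_of_ne hne.2 with hzy | hyz
    · exact not_three hx0 hxz hzy hx hfz hy
    · exact not_three hx0 (hxc.trans hcy) hyz hx hy hfz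

/-- In the variable `s = r ^ 2`, the apsis equation multiplied by `r ^ 2` is a linear function plus
a power of exponent `1 - α / 2`. -/
theorem sq_mul_apsis_eq (α ℓ h : ℝ) {r : ℝ} (hr : 0 < r) :
    h * r ^ 2 + (r ^ 2) ^ (1 - α / 2) / α - ℓ ^ 2 / 2 =
      r ^ 2 * (h + r ^ (-α) / α - ℓ ^ 2 / (2 * r ^ 2)) := by
  have hpow : (r ^ 2) ^ (1 - α / 2) = r ^ 2 * r ^ (-α) := by
    rw [← Real.rpow_natCast r 2, ← Real.rpow_mul hr.le, ← Real.rpow_add hr]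
    congr 1
    push_cast
    ring
  rw [hpow]
  field_simp

theorem strictConcaveOn_linear_add_rpow {α : ℝ} (hα0 : 0 < α) (hα2 : α < 2) (ℓ h : ℝ) :
    StrictConcaveOn ℝ (Set.Ici 0)
      (fun s : ℝ => h * s + s ^ (1 - α / 2) / α - ℓ ^ 2 / 2) := by
  have hp := Real.strictConcaveOn_rpow (p := 1 - α / 2) (by linarith) (by linarith)
  refine ⟨convex_Ici 0, fun x hx y hy hxy a b ha hb hab => ?_⟩
  have key := div_lt_div_of_pos_right (hp.2 hx hy hxy ha hb hab) hα0
  simp only [smul_eq_mul] at key ⊢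
  obtain rfl : b = 1 - a := by linarith
  rw [add_div] at key
  linear_combination key

/-- The lower bound on the energy makes the apsis function positive at the circular radius
`ℓ ^ (2 / (2 - α))`. -/
theorem apsis_pos_at_circular_radius {α ℓ h : ℝ} (hℓ : 0 < ℓ) (hα0 : 0 < α) (hα2 : α < 2)
    (hlb : (α - 2) / (2 * α) * ℓ ^ (2 * α / (α - 2)) < h) :
    0 < h + (ℓ ^ (2 / (2 - α))) ^ (-α) / α - ℓ ^ 2 / (2 * (ℓ ^ (2 / (2 - α))) ^ 2) := by
  have hne : 2 - α ≠ 0 := by linarith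
  have hne' : α - 2 ≠ 0 := by linarith
  have h1 : (ℓ ^ (2 / (2 - α))) ^ (-α) = ℓ ^ (2 * α / (α - 2)) := by
    rw [← Real.rpow_mul hℓ.le]
    congr 1
    rw [← neg_sub 2 α, div_neg]
    ring
  have h2 : ℓ ^ 2 / (2 * (ℓ ^ (2 / (2 - α))) ^ 2) = ℓ ^ (2 * α / (α - 2)) / 2 := by
    rw [mul_comm 2, ← div_div, ← Real.rpow_natCast (ℓ ^ _) 2, ← Real.rpow_mul hℓ.le,
      ← Real.rpow_natCast ℓ 2, ← Real.rpow_sub hℓ]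
    congr 2
    rw [← neg_sub 2 α, div_neg]
    field_simp
    push_cast
    ring
  rw [h1, h2]
  have h3 : (α - 2) / (2 * α) * ℓ ^ (2 * α / (α - 2)) =
      ℓ ^ (2 * α / (α - 2)) / 2 - ℓ ^ (2 * α / (α - 2)) / α := by
    field_simp
  linarith

/-- For negative energy the apsis function is negative at arbitrarily large radii. -/
theorem exists_gt_apsis_neg {α h : ℝ} (hα0 : 0 < α) (hub : h < 0) (ℓ c : ℝ) :
    ∃ r > c, h + r ^ (-α) / α - ℓ ^ 2 / (2 * r ^ 2) < 0 := by
  have hlim := (tendsto_rpow_neg_atTop hα0).eventually_lt_const (u := -h * α) (by nlinarith)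
  obtain ⟨r, hr, hrc⟩ := (hlim.and (Filter.eventually_gt_atTop c)).exists
  have h1 : r ^ (-α) / α < -h := (div_lt_iff₀ hα0).2 hr
  have h2 : 0 ≤ ℓ ^ 2 / (2 * r ^ 2) := by positivity
  exact ⟨r, hrc, by linarith⟩

/-- For `ℓ > 0`, `0 < α < 2` and any energy `h` with
`((α-2)/(2α)) ℓ^(2α/(α-2)) < h < 0`, the radial apsis equation
`h + r^(-α)/α - ℓ²/(2r²) = 0` has exactly two positive solutions `rlo < rhi`. -/
theorem exists_two_apsidal (α ℓ h : ℝ) (hℓ : 0 < ℓ) (hα0 : 0 < α) (hα2 : α < 2)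
    (hlb : (α - 2) / (2 * α) * ℓ ^ (2 * α / (α - 2)) < h) (hub : h < 0) :
    ∃ rlo rhi : ℝ, 0 < rlo ∧ rlo < rhi ∧
      h + rlo ^ (-α) / α - ℓ ^ 2 / (2 * rlo ^ 2) = 0 ∧
      h + rhi ^ (-α) / α - ℓ ^ 2 / (2 * rhi ^ 2) = 0 ∧
      ∀ r : ℝ, 0 < r → h + r ^ (-α) / α - ℓ ^ 2 / (2 * r ^ 2) = 0 → r = rlo ∨ r = rhi := by
  set r₀ := ℓ ^ (2 / (2 - α)) with hr₀
  have hr₀pos : 0 < r₀ := Real.rpow_pos_of_pos hℓ _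
  have hmid := apsis_pos_at_circular_radius hℓ hα0 hα2 hlb
  rw [← hr₀] at hmid
  obtain ⟨r₁, hr₀₁, hend⟩ := exists_gt_apsis_neg hα0 hub ℓ r₀
  have hr₁pos : 0 < r₁ := hr₀pos.trans hr₀₁
  have hp : 0 < 1 - α / 2 := by linarith
  have hcont : Continuous fun s : ℝ => h * s + s ^ (1 - α / 2) / α - ℓ ^ 2 / 2 :=
    (((continuous_const.mul continuous_id).add
      ((Real.continuous_rpow_const hp.le).div_const α)).sub continuous_const)
  obtain ⟨x, y, hx, hxy, hfx, hfy, huniq⟩ :=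
    (strictConcaveOn_linear_add_rpow hα0 hα2 ℓ h).exists_two_zeros hcont
      (c := r₀ ^ 2) (d := r₁ ^ 2) (by positivity) (by gcongr)
      (by simp only [Real.zero_rpow hp.ne']; simp; positivity)
      (by simp only [sq_mul_apsis_eq α ℓ h hr₀pos]; positivity)
      (by simp only [sq_mul_apsis_eq α ℓ h hr₁pos]; exact mul_neg_of_pos_of_neg (by positivity) hend)
  have hy := hx.trans hxy
  have root_of_sq : ∀ {s : ℝ}, 0 < s → h * s + s ^ (1 - α / 2) / α - ℓ ^ 2 / 2 = 0 →
      h + √s ^ (-α) / α - ℓ ^ 2 / (2 * √s ^ 2) = 0 := by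
    intro s hs hfs
    have hmul := sq_mul_apsis_eq α ℓ h (Real.sqrt_pos.2 hs)
    rw [Real.sq_sqrt hs.le, hfs] at hmul
    rw [Real.sq_sqrt hs.le]
    exact (mul_eq_zero.1 hmul.symm).resolve_left hs.ne'
  refine ⟨√x, √y, Real.sqrt_pos.2 hx, Real.sqrt_lt_sqrt hx.le hxy, root_of_sq hx hfx,
    root_of_sq hy hfy, fun r hr hroot => ?_⟩
  have hfr := sq_mul_apsis_eq α ℓ h hr
  rw [hroot, mul_zero] at hfr
  refine (huniq (r ^ 2) (by positivity) hfr).imp ?_ ?_ <;>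
  · rintro rfl
    exact (Real.sqrt_sq hr.le).symm
end

section
/- Let ℓ > 0 and α < 2 with α ≠ 0, and suppose r₋ < r₊ are two distinct positive solutions of the equation h + r^(−α)/α − ℓ²/(2r²) = 0 for some energy h. Then r₋ < ℓ^(2/(2−α)) < r₊; that is, the circular-motion radius lies strictly between the two apsidal radii. -/
/-- The left-hand side of the radial apsis equation has derivative `-r^(-α-1) + ℓ²/r³`. -/
theorem hasDerivAt_apsis (α ℓ h : ℝ) (hα0 : α ≠ 0) {r : ℝ} (hr : 0 < r) :
    HasDerivAt (fun x : ℝ => h + x ^ (-α) / α - ℓ ^ 2 / (2 * x ^ 2))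
      (-r ^ (-α - 1) + ℓ ^ 2 / r ^ 3) r := by
  have hpow := ((Real.hasDerivAt_rpow_const (p := -α) (Or.inl hr.ne')).div_const α).const_add h
  have hcent := (hasDerivAt_const r (ℓ ^ 2)).fun_div ((hasDerivAt_pow 2 r).const_mul 2)
    (by positivity)
  refine (hpow.fun_sub hcent).congr_deriv ?_
  field_simp
  ring

/-- The circular-motion radius `r* = ℓ^(2/(2-α))` is the only critical point. -/
theorem eq_circular_radius (α ℓ : ℝ) (hℓ : 0 < ℓ) (hα2 : α < 2) {r : ℝ} (hr : 0 < r)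
    (hcrit : -r ^ (-α - 1) + ℓ ^ 2 / r ^ 3 = 0) : r = ℓ ^ (2 / (2 - α)) := by
  have hne : 2 - α ≠ 0 := by linarith
  have hmul : r ^ (2 - α) = r ^ (-α - 1) * r ^ 3 := by
    rw [← Real.rpow_natCast r 3, ← Real.rpow_add hr]
    congr 1
    push_cast
    ring
  have hsq : r ^ (2 - α) = ℓ ^ (2 : ℝ) := by
    rw [hmul, Real.rpow_two, show r ^ (-α - 1) = ℓ ^ 2 / r ^ 3 by linarith]
    field_simp
  rw [div_eq_mul_inv, Real.rpow_mul hℓ.le, ← hsq, Real.rpow_rpow_inv hr.le hne]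

/-- The circular-motion radius `r* = ℓ^(2/(2-α))` lies strictly between any two distinct
positive solutions of the radial apsis equation `h + r^(-α)/α - ℓ²/(2r²) = 0`. -/
theorem circular_radius_between (α ℓ h rlo rhi : ℝ) (hℓ : 0 < ℓ) (hα2 : α < 2)
    (hα0 : α ≠ 0) (hpos : 0 < rlo) (hlt : rlo < rhi)
    (heqlo : h + rlo ^ (-α) / α - ℓ ^ 2 / (2 * rlo ^ 2) = 0)
    (heqhi : h + rhi ^ (-α) / α - ℓ ^ 2 / (2 * rhi ^ 2) = 0) :
    rlo < ℓ ^ (2 / (2 - α)) ∧ ℓ ^ (2 / (2 - α)) < rhi := by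
  have hderiv : ∀ x, rlo ≤ x → HasDerivAt
      (fun x : ℝ => h + x ^ (-α) / α - ℓ ^ 2 / (2 * x ^ 2)) (-x ^ (-α - 1) + ℓ ^ 2 / x ^ 3) x :=
    fun x hx => hasDerivAt_apsis α ℓ h hα0 (hpos.trans_le hx)
  obtain ⟨c, hc, hcrit⟩ := exists_hasDerivAt_eq_zero hlt
    (fun x hx => (hderiv x hx.1).continuousAt.continuousWithinAt)
    (heqlo.trans heqhi.symm) (fun x hx => hderiv x hx.1.le)
  rw [← eq_circular_radius α ℓ hℓ hα2 (hpos.trans hc.1) hcrit]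
  exact hc
end
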